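/- Termination of Algorithm 1 with a bound by the number of subset-maximal solutions: for any finite family F of finsets of α and any R : Finset α, there exists n ≤ (Setmax R F).card such that F_n = ∅, where (F_n) is the maximization iteration of Algorithm 1 starting from F; in particular, the number of cardinality-optimization subcalls performed by Algorithm 1 is at most the number of subset-maximal solutions. -/

import Mathlib

/-- Subset-maximal solutions of a family `F` of finsets, relative to `R`. -/
def Setmax {α : Type*} [DecidableEq α] (R : Finset α) (F : Set (Finset α)) :
    Set (Finset α) :=
  {s ∈ F | ¬ ∃ s' ∈ F, s ∩ R ⊂ s' ∩ R}

/-- Cardinality-maximal solutions of a family `F` of finsets, relative to `R`. -/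
def Cardmax {α : Type*} [DecidableEq α] (R : Finset α) (F : Set (Finset α)) :
    Set (Finset α) :=
  {s ∈ F | ∀ s' ∈ F, (s' ∩ R).card ≤ (s ∩ R).card}

/-- The maximization iteration of Algorithm 1 starting from `F`:
`F_0 = F` and `F_{n+1}` consists of those members of `F_n` whose restriction to
`R` is not contained in the restriction of any cardinality-maximal member of `F_n`. -/
def iterMax {α : Type*} [DecidableEq α] (R : Finset α) (F : Set (Finset α)) :
    ℕ → Set (Finset α)
  | 0 => F
  | n + 1 =>
      {s' ∈ iterMax R F n | ¬ ∃ s ∈ Cardmax R (iterMax R F n), s' ∩ R ⊆ s ∩ R}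

theorem iterMax_sub {α : Type*} [DecidableEq α] (R : Finset α) (F : Set (Finset α)) (n : ℕ) :
    iterMax R F n ⊆ F := by
  induction n with
  | zero => exact subset_rfl
  | succ n ih => exact fun s hs => ih hs.1

theorem iterMax_up {α : Type*} [DecidableEq α] (R : Finset α) (F : Set (Finset α)) (n : ℕ) :
    ∀ s ∈ iterMax R F n, ∀ s' ∈ F, s ∩ R ⊆ s' ∩ R → s' ∈ iterMax R F n := by
  induction n with
  | zero => exact fun _ _ s' hs' _ => hs'
  | succ n ih =>
    intro s hs s' hs' h
    refine ⟨ih s hs.1 s' hs' h, ?_⟩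
    rintro ⟨c, hc, hcs⟩
    exact hs.2 ⟨c, hc, h.trans hcs⟩

theorem iterMax_exists {α : Type*} [DecidableEq α] (R : Finset α) (F : Set (Finset α))
    (hF : F.Finite) (n : ℕ) (hne : iterMax R F n ≠ ∅) :
    ∃ c ∈ Cardmax R (iterMax R F n), c ∈ Setmax R F := by
  have hfin := hF.subset (iterMax_sub R F n)
  obtain ⟨c, hc, hmax⟩ := Set.exists_max_image (iterMax R F n) (fun s => (s ∩ R).card) hfin
    (Set.nonempty_iff_ne_empty.2 hne)
  refine ⟨c, ⟨hc, hmax⟩, iterMax_sub R F n hc, ?_⟩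
  rintro ⟨s', hs', hlt⟩
  have h1 := hmax s' (iterMax_up R F n c hc s' hs' hlt.1)
  have h2 := Finset.card_lt_card hlt
  exact absurd h2 (not_lt.2 h1)

/-- Termination of Algorithm 1 with a bound by the number of subset-maximal
solutions: some stage with index at most `(Setmax R F).ncard` is empty. -/
theorem iterMax_terminates {α : Type*} [DecidableEq α]
    (R : Finset α) (F : Set (Finset α)) (hF : F.Finite) :
    ∃ n ≤ (Setmax R F).ncard, iterMax R F n = ∅ := by
  by_contra hcon
  push Not at hcon
  have hSfin : (Setmax R F).Finite := hF.subset fun s hs => hs.1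
  have key : ∀ n, n ≤ (Setmax R F).ncard →
      n + (Setmax R F ∩ iterMax R F n).ncard ≤ (Setmax R F).ncard := by
    intro n
    induction n with
    | zero =>
      intro _
      rw [zero_add]
      exact Set.ncard_le_ncard Set.inter_subset_left hSfin
    | succ n ih =>
      intro hn
      have h1 := ih (by omega)
      obtain ⟨c, hc, hcS⟩ := iterMax_exists R F hF n
        (Set.nonempty_iff_ne_empty.1 (by simpa [Set.nonempty_iff_ne_empty] using hcon n (by omega)))
      have h2 : (Setmax R F ∩ iterMax R F (n + 1)).ncard
          < (Setmax R F ∩ iterMax R F n).ncard := by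
        apply Set.ncard_lt_ncard _ (hSfin.subset Set.inter_subset_left)
        refine ⟨fun s hs => ⟨hs.1, hs.2.1⟩, fun h => ?_⟩
        exact (h ⟨hcS, hc.1⟩).2.2 ⟨c, hc, subset_rfl⟩
      omega
  have h := key _ le_rfl
  obtain ⟨c, hc, hcS⟩ := iterMax_exists R F hF _
    (Set.nonempty_iff_ne_empty.1 (by simpa [Set.nonempty_iff_ne_empty] using hcon _ le_rfl))
  have h3 : 0 < (Setmax R F ∩ iterMax R F (Setmax R F).ncard).ncard :=
    (Set.ncard_pos (hSfin.subset Set.inter_subset_left)).2 ⟨c, hcS, hc.1⟩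
  omega
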